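/- Suppose y ∈ ℝ is not of the form f(k/2^{2m}) for any balanced pair (k, m), and suppose the set of principal balanced pairs (k, m) with y ∈ f(I(k, m)) is finite. Then the level set L_f(y) = {x ∈ [0,1] : f(x) = y} is a finite set. -/

import Mathlib

/-- `phi x` is the distance from `x` to the nearest integer. -/
noncomputable def phi (x : ℝ) : ℝ := |x - round x|

/-- The signed Takagi function associated to the sign sequence `r`. -/
noncomputable def takagi (r : ℕ → ℝ) (x : ℝ) : ℝ :=
  ∑' n : ℕ, r n / 2 ^ n * phi (2 ^ n * x)

/-- `eps n x` is the `n`-th binary digit of `x ∈ [0,1)` (for `n ≥ 1`), using the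
terminating expansion for dyadic rationals. -/
noncomputable def eps (n : ℕ) (x : ℝ) : ℕ := (⌊2 ^ n * x⌋ % 2).toNat

/-- `Dfun r k x = ∑_{j=1}^k r_{j-1} (-1)^{ε_j(x)}`. -/
noncomputable def Dfun (r : ℕ → ℝ) (k : ℕ) (x : ℝ) : ℝ :=
  ∑ j ∈ Finset.Icc 1 k, r (j - 1) * (-1 : ℝ) ^ eps j x

/-- `(k, m)` is a balanced pair if `0 ≤ k < 2^{2m}` and `D_{2m}(k/2^{2m}) = 0`. -/
def BalancedPair (r : ℕ → ℝ) (k m : ℕ) : Prop :=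
  k < 2 ^ (2 * m) ∧ Dfun r (2 * m) ((k : ℝ) / 2 ^ (2 * m)) = 0

/-- The generation of a balanced pair `(k, m)`: the number of indices
`1 ≤ j ≤ 2m` with `D_j(k/2^{2m}) = 0`. -/
noncomputable def generation (r : ℕ → ℝ) (k m : ℕ) : ℕ :=
  {j : ℕ | 1 ≤ j ∧ j ≤ 2 * m ∧ Dfun r j ((k : ℝ) / 2 ^ (2 * m)) = 0}.ncard

theorem phi_eq_norm (x : ℝ) : phi x = ‖(x : UnitAddCircle)‖ := by
  rw [UnitAddCircle.norm_eq, phi]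

theorem continuous_phi : Continuous phi := by
  have : phi = fun x : ℝ => ‖(x : UnitAddCircle)‖ := funext phi_eq_norm
  rw [this]
  exact continuous_norm.comp (AddCircle.continuous_mk' 1)

theorem phi_nonneg (x : ℝ) : 0 ≤ phi x := abs_nonneg _

theorem phi_le_half (x : ℝ) : phi x ≤ 1 / 2 := abs_sub_round x

theorem phi_intCast (k : ℤ) : phi k = 0 := by simp [phi]

theorem phi_add_intCast (x : ℝ) (k : ℤ) : phi (x + k) = phi x := by
  simp [phi, round_add_intCast]

theorem phi_of_mem_Icc_zero_half {x : ℝ} (h0 : 0 ≤ x) (h1 : x ≤ 1 / 2) : phi x = x := by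
  rcases h1.lt_or_eq with h1 | rfl
  · rw [phi, round_eq_zero_iff.2 ⟨by linarith, h1⟩]
    simpa using h0
  · norm_num [phi, round_eq]

theorem phi_neg (x : ℝ) : phi (-x) = phi x := by
  simp [phi_eq_norm]

/-- `phi` is affine on each interval `[l / 2, (l + 1) / 2]`. -/
theorem phi_half_intCast_add (l : ℤ) {t : ℝ} (h0 : 0 ≤ t) (h1 : t ≤ 1 / 2) :
    phi (l / 2 + t) = phi (l / 2) + (-1) ^ (l % 2).toNat * t := by
  rcases Int.even_or_odd' l with ⟨q, rfl | rfl⟩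
  · have e : (((2 * q : ℤ) : ℝ) / 2 + t) = t + q := by push_cast; ring
    have e' : (((2 * q : ℤ) : ℝ) / 2) = (q : ℝ) := by push_cast; ring
    rw [e, e', phi_add_intCast, phi_intCast, phi_of_mem_Icc_zero_half h0 h1]
    simp
  · have e : (((2 * q + 1 : ℤ) : ℝ) / 2 + t) = -(1 / 2 - t) + (q + 1 : ℤ) := by push_cast; ring
    have e' : (((2 * q + 1 : ℤ) : ℝ) / 2) = 1 / 2 + (q : ℝ) := by push_cast; ring
    have e2 : (2 * q + 1) % 2 = 1 := by omega
    rw [e, e', phi_add_intCast, phi_add_intCast, phi_neg,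
      phi_of_mem_Icc_zero_half (by linarith) (by linarith),
      phi_of_mem_Icc_zero_half (by norm_num) le_rfl, e2]
    norm_num
    ring

theorem norm_takagi_term_le {r : ℕ → ℝ} (hr : ∀ n, r n = 1 ∨ r n = -1) (n : ℕ) (x : ℝ) :
    ‖r n / 2 ^ n * phi (2 ^ n * x)‖ ≤ (1 / 2) ^ n := by
  have h : |r n| = 1 := by rcases hr n with h | h <;> simp [h]
  have h2 : phi (2 ^ n * x) ≤ 1 := (phi_le_half _).trans (by norm_num)
  rw [norm_mul, norm_div, Real.norm_eq_abs, h, Real.norm_eq_abs, Real.norm_eq_abs,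
    abs_of_nonneg (phi_nonneg _), abs_of_pos (by positivity), one_div_pow]
  exact mul_le_of_le_one_right (by positivity) h2

theorem summable_takagi {r : ℕ → ℝ} (hr : ∀ n, r n = 1 ∨ r n = -1) (x : ℝ) :
    Summable fun n => r n / 2 ^ n * phi (2 ^ n * x) :=
  .of_norm_bounded summable_geometric_two fun n => norm_takagi_term_le hr n x

theorem continuous_takagi {r : ℕ → ℝ} (hr : ∀ n, r n = 1 ∨ r n = -1) :
    Continuous (takagi r) := by
  refine continuous_tsum (fun n => ?_) summable_geometric_two
    fun n x => norm_takagi_term_le hr n x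
  exact continuous_const.mul (continuous_phi.comp (continuous_const.mul continuous_id))

theorem takagi_intCast (r : ℕ → ℝ) (k : ℤ) : takagi r k = 0 := by
  have h (n : ℕ) : phi (2 ^ n * k) = 0 := by
    exact_mod_cast phi_intCast (2 ^ n * k)
  simp [takagi, h]

theorem takagi_one_half (r : ℕ → ℝ) : takagi r (1 / 2) = r 0 / 2 := by
  rw [takagi, tsum_eq_single 0]
  · simp only [pow_zero, one_mul]
    rw [phi_of_mem_Icc_zero_half (by norm_num) le_rfl]
    ring
  · intro n hn
    obtain ⟨n, rfl⟩ := Nat.exists_eq_succ_of_ne_zero hn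
    have e : (2 : ℝ) ^ (n + 1) * (1 / 2) = ((2 ^ n : ℤ) : ℝ) := by push_cast; ring
    rw [Nat.succ_eq_add_one, e, phi_intCast, mul_zero]

theorem takagi_neg (r : ℕ → ℝ) (x : ℝ) : takagi (fun n => -r n) x = -takagi r x := by
  simp only [takagi, neg_div, neg_mul, tsum_neg]

theorem floor_two_pow_succ_div_two (n : ℕ) (x : ℝ) : ⌊2 ^ (n + 1) * x⌋ / 2 = ⌊2 ^ n * x⌋ := by
  have h := Int.floor_div_natCast (2 ^ (n + 1) * x) 2
  have e : 2 ^ (n + 1) * x / (2 : ℕ) = 2 ^ n * x := by push_cast; ring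
  rw [e] at h
  exact_mod_cast h.symm

theorem floor_two_pow_congr {n : ℕ} {x x' : ℝ} (h : ⌊2 ^ n * x⌋ = ⌊2 ^ n * x'⌋) :
    ∀ {j : ℕ}, j ≤ n → ⌊2 ^ j * x⌋ = ⌊2 ^ j * x'⌋ := by
  intro j hj
  induction hj using Nat.decreasingInduction with
  | self => exact h
  | of_succ j _ ih => rw [← floor_two_pow_succ_div_two, ih, floor_two_pow_succ_div_two]

theorem floor_two_pow_mul_div (n : ℕ) (k : ℤ) {t : ℝ} (h0 : 0 ≤ t) (h1 : t < 1) :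
    ⌊2 ^ n * ((k + t) / 2 ^ n)⌋ = k := by
  rw [mul_div_cancel₀ _ (by positivity), Int.floor_intCast_add, Int.floor_eq_zero_iff.2 ⟨h0, h1⟩,
    add_zero]

theorem floor_two_pow_mul_intCast_div (n : ℕ) (k : ℤ) : ⌊(2 : ℝ) ^ n * (k / 2 ^ n)⌋ = k := by
  simpa using floor_two_pow_mul_div n k le_rfl one_pos

theorem Dfun_congr (r : ℕ → ℝ) {n : ℕ} {x x' : ℝ} (h : ⌊2 ^ n * x⌋ = ⌊2 ^ n * x'⌋) {j : ℕ}
    (hj : j ≤ n) : Dfun r j x = Dfun r j x' := by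
  refine Finset.sum_congr rfl fun i hi => ?_
  rw [eps, eps, floor_two_pow_congr h ((Finset.mem_Icc.1 hi).2.trans hj)]

theorem Dfun_floor (r : ℕ → ℝ) (n : ℕ) (x : ℝ) :
    Dfun r n (⌊2 ^ n * x⌋ / 2 ^ n) = Dfun r n x :=
  Dfun_congr r (floor_two_pow_mul_intCast_div n _) le_rfl

theorem Dfun_zero (r : ℕ → ℝ) (x : ℝ) : Dfun r 0 x = 0 := by simp [Dfun]

theorem Dfun_succ (r : ℕ → ℝ) (n : ℕ) (x : ℝ) :
    Dfun r (n + 1) x = Dfun r n x + r n * (-1) ^ (⌊2 ^ (n + 1) * x⌋ % 2).toNat := by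
  rw [Dfun, Finset.sum_Icc_succ_top (by omega)]
  rfl

theorem Dfun_eq_sum_range (r : ℕ → ℝ) (n : ℕ) (x : ℝ) :
    Dfun r n x = ∑ i ∈ Finset.range n, r i * (-1) ^ (⌊2 ^ (i + 1) * x⌋ % 2).toNat := by
  induction n with
  | zero => simp [Dfun]
  | succ n ih => rw [Dfun_succ, Finset.sum_range_succ, ih]

theorem Dfun_neg (r : ℕ → ℝ) (n : ℕ) (x : ℝ) : Dfun (fun i => -r i) n x = -Dfun r n x := by
  simp [Dfun]

theorem exists_intCast_eq_Dfun {r : ℕ → ℝ} (hr : ∀ n, r n = 1 ∨ r n = -1) (n : ℕ) (x : ℝ) :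
    ∃ d : ℤ, Dfun r n x = d ∧ d % 2 = n % 2 := by
  induction n with
  | zero => exact ⟨0, by simp [Dfun]⟩
  | succ n ih =>
    obtain ⟨d, hd, hp⟩ := ih
    rw [Dfun_succ, hd]
    rcases hr n with h | h <;>
      rcases neg_one_pow_eq_or ℝ (⌊2 ^ (n + 1) * x⌋ % 2).toNat with h' | h' <;> rw [h, h']
    · exact ⟨d + 1, by push_cast; ring, by push_cast; omega⟩
    · exact ⟨d - 1, by push_cast; ring, by push_cast; omega⟩
    · exact ⟨d - 1, by push_cast; ring, by push_cast; omega⟩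
    · exact ⟨d + 1, by push_cast; ring, by push_cast; omega⟩

/-- Self-similarity of the signed Takagi function on dyadic intervals. -/
theorem takagi_intCast_add_div {r : ℕ → ℝ} (hr : ∀ n, r n = 1 ∨ r n = -1) (n : ℕ) (k : ℤ) {t : ℝ}
    (h0 : 0 ≤ t) (h1 : t ≤ 1) :
    takagi r ((k + t) / 2 ^ n) = takagi r (k / 2 ^ n) + Dfun r n (k / 2 ^ n) * t / 2 ^ n
      + takagi (fun i => r (i + n)) t / 2 ^ n := by
  have split (x : ℝ) := (summable_takagi hr x).sum_add_tsum_nat_add n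
  have tail (s : ℝ) : ∑' i, r (i + n) / 2 ^ (i + n) * phi (2 ^ (i + n) * ((k + s) / 2 ^ n)) =
      takagi (fun i => r (i + n)) s / 2 ^ n := by
    rw [takagi, ← tsum_div_const]
    refine tsum_congr fun i => ?_
    have e : (2 : ℝ) ^ (i + n) * ((k + s) / 2 ^ n) = 2 ^ i * s + ((2 ^ i * k : ℤ) : ℝ) := by
      push_cast
      rw [pow_add]
      field_simp
      ring
    rw [e, phi_add_intCast, pow_add]
    field_simp
  have tail0 := tail 0
  rw [add_zero, show (0 : ℝ) = ((0 : ℤ) : ℝ) by simp, takagi_intCast, zero_div] at tail0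
  have head : ∑ i ∈ Finset.range n, r i / 2 ^ i * phi (2 ^ i * ((k + t) / 2 ^ n)) =
      ∑ i ∈ Finset.range n, r i / 2 ^ i * phi (2 ^ i * (k / 2 ^ n))
        + Dfun r n (k / 2 ^ n) * t / 2 ^ n := by
    rw [Dfun_eq_sum_range, Finset.sum_mul, Finset.sum_div, ← Finset.sum_add_distrib]
    refine Finset.sum_congr rfl fun i hi => ?_
    obtain ⟨m, rfl⟩ := Nat.exists_eq_add_of_le (Nat.succ_le_of_lt (Finset.mem_range.1 hi))
    set l := ⌊(2 : ℝ) ^ (i + 1) * (k / 2 ^ (i + 1 + m))⌋ with hl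
    have hlk : l = k / 2 ^ m := by
      have e : (2 : ℝ) ^ (i + 1) * (k / 2 ^ (i + 1 + m)) = k / ((2 ^ m : ℕ) : ℝ) := by
        push_cast
        rw [pow_add 2 (i + 1) m]
        field_simp
      rw [hl, e, Int.floor_div_natCast, Int.floor_intCast]
      push_cast
      rfl
    have hb0 : 0 ≤ k % 2 ^ m := Int.emod_nonneg _ (by positivity)
    have hb1 : k % 2 ^ m + 1 ≤ 2 ^ m := Int.emod_lt_of_pos _ (by positivity)
    have hk : (k : ℝ) = 2 ^ m * l + (k % 2 ^ m : ℤ) := by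
      rw [hlk]
      exact_mod_cast (Int.mul_ediv_add_emod k (2 ^ m)).symm
    generalize k % 2 ^ m = b at hb0 hb1 hk
    have hb0' : (0 : ℝ) ≤ b := by exact_mod_cast hb0
    have hb1' : (b : ℝ) + 1 ≤ 2 ^ m := by exact_mod_cast hb1
    have e (s : ℝ) : 2 ^ i * ((k + s) / 2 ^ (i + 1 + m)) = l / 2 + (b + s) / 2 ^ m / 2 := by
      rw [hk, pow_add, pow_succ]
      field_simp
      ring
    have affine {s : ℝ} (hs0 : 0 ≤ s) (hs1 : s ≤ 1) :=
      phi_half_intCast_add l (t := (b + s) / 2 ^ m / 2) (by positivity) (by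
        have : (b + s) / 2 ^ m ≤ 1 := (div_le_one (by positivity)).2 (by linarith)
        linarith)
    have e0 := e 0
    have a0 := affine le_rfl zero_le_one
    rw [add_zero] at e0
    rw [e, e0, affine h0 h1, a0, Nat.succ_eq_add_one, pow_add, pow_succ]
    field_simp
    ring
  unfold takagi at tail ⊢
  rw [← split, ← split (k / 2 ^ n), tail, tail0, head]
  ring

theorem takagi_intCast_add_one_div {r : ℕ → ℝ} (hr : ∀ n, r n = 1 ∨ r n = -1) (n : ℕ) (k : ℤ) :
    takagi r ((k + 1) / 2 ^ n) = takagi r (k / 2 ^ n) + Dfun r n (k / 2 ^ n) / 2 ^ n := by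
  have h := takagi_intCast_add_div hr n k zero_le_one le_rfl
  have h1 := takagi_intCast (fun i => r (i + n)) 1
  rw [Int.cast_one] at h1
  rw [h, h1]
  ring

theorem takagi_dyadic_midpoint {r : ℕ → ℝ} (hr : ∀ n, r n = 1 ∨ r n = -1) (n : ℕ) (k : ℤ) :
    takagi r ((2 * k + 1) / 2 ^ (n + 1)) =
      takagi r (k / 2 ^ n) + (Dfun r n (k / 2 ^ n) + r n) / 2 ^ (n + 1) := by
  have h := takagi_intCast_add_div hr n k (t := 1 / 2) (by norm_num) (by norm_num)
  have e : ((2 * k + 1) / 2 ^ (n + 1) : ℝ) = (k + 1 / 2) / 2 ^ n := by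
    rw [pow_succ]
    field_simp
  rw [e, h, takagi_one_half, zero_add, pow_succ]
  field_simp
  ring

theorem Dfun_dyadic_child_of_le (r : ℕ → ℝ) {n j : ℕ} (hj : j ≤ n) (q : ℤ) {e : ℤ}
    (he : e = 0 ∨ e = 1) :
    Dfun r j ((2 * q + e : ℤ) / 2 ^ (n + 1)) = Dfun r j (q / 2 ^ n) := by
  refine Dfun_congr r ?_ hj
  rw [floor_two_pow_mul_intCast_div, ← floor_two_pow_succ_div_two, floor_two_pow_mul_intCast_div]
  omega

theorem Dfun_dyadic_child (r : ℕ → ℝ) (n : ℕ) (q : ℤ) {e : ℤ} {δ : ℝ}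
    (he : e = 0 ∧ δ = 1 ∨ e = 1 ∧ δ = -1) :
    Dfun r (n + 1) ((2 * q + e : ℤ) / 2 ^ (n + 1)) = Dfun r n (q / 2 ^ n) + r n * δ := by
  rw [Dfun_succ, Dfun_dyadic_child_of_le r le_rfl q (he.imp And.left And.left),
    floor_two_pow_mul_intCast_div]
  rcases he with ⟨rfl, rfl⟩ | ⟨rfl, rfl⟩
  · simp
  · rw [show (2 * q + 1) % 2 = 1 by omega]
    simp

/-- The midpoint value of the chord of `takagi r` over a dyadic interval changes in passing to a
half of the interval by an amount depending only on the slope times the digit sign. -/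
theorem chord_midpoint_dyadic_child {r : ℕ → ℝ} (hr : ∀ n, r n = 1 ∨ r n = -1) (n : ℕ) (q : ℤ)
    {e : ℤ} {δ : ℝ} (he : e = 0 ∧ δ = 1 ∨ e = 1 ∧ δ = -1) :
    takagi r ((2 * q + e : ℤ) / 2 ^ (n + 1)) +
        Dfun r (n + 1) ((2 * q + e : ℤ) / 2 ^ (n + 1)) / 2 ^ (n + 2) =
      takagi r (q / 2 ^ n) + Dfun r n (q / 2 ^ n) / 2 ^ (n + 1) +
        (r n - δ * Dfun r n (q / 2 ^ n)) / 2 ^ (n + 2) := by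
  rw [Dfun_dyadic_child r n q he]
  rcases he with ⟨rfl, rfl⟩ | ⟨rfl, rfl⟩
  · have e : (((2 * q + 0 : ℤ) : ℝ) / 2 ^ (n + 1)) = q / 2 ^ n := by
      push_cast
      rw [pow_succ]
      field_simp
      ring
    rw [e, pow_succ _ (n + 1)]
    field_simp
    ring
  · push_cast
    rw [takagi_dyadic_midpoint hr, pow_succ _ (n + 1)]
    field_simp
    ring

/-- Reflecting the negative excursions of the walk `Dfun` preserves the midpoint values of the
chords of `takagi r` over dyadic intervals. -/
theorem exists_dyadic_Dfun_eq_abs {r : ℕ → ℝ} (hr : ∀ n, r n = 1 ∨ r n = -1) (n : ℕ) :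
    ∀ k : ℤ, 0 ≤ k → k < 2 ^ n → ∃ k' : ℤ, 0 ≤ k' ∧ k' < 2 ^ n ∧
      (∀ j ≤ n, Dfun r j (k' / 2 ^ n) = |Dfun r j (k / 2 ^ n)|) ∧
      takagi r (k' / 2 ^ n) + Dfun r n (k' / 2 ^ n) / 2 ^ (n + 1) =
        takagi r (k / 2 ^ n) + Dfun r n (k / 2 ^ n) / 2 ^ (n + 1) := by
  induction n with
  | zero =>
    intro k h0 h1
    refine ⟨k, h0, h1, fun j hj => ?_, rfl⟩
    rw [Nat.le_zero.1 hj]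
    simp [Dfun_zero]
  | succ n ih =>
    intro k h0 h1
    obtain ⟨q, e, he, rfl⟩ : ∃ q e : ℤ, (e = 0 ∨ e = 1) ∧ k = 2 * q + e :=
      ⟨k / 2, k % 2, by omega, by omega⟩
    rw [pow_succ] at h1
    obtain ⟨q', hq0, hq1, hD, hM⟩ := ih q (by omega) (by omega)
    obtain ⟨δ, heδ⟩ : ∃ δ : ℝ, e = 0 ∧ δ = 1 ∨ e = 1 ∧ δ = -1 := by
      rcases he with rfl | rfl
      · exact ⟨1, by simp⟩
      · exact ⟨-1, by simp⟩
    have hδ : δ = 1 ∨ δ = -1 := heδ.imp And.right And.right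
    have hDn := hD n le_rfl
    have key : ∃ δ' : ℝ, (δ' = 1 ∨ δ' = -1) ∧ δ' * |Dfun r n (q / 2 ^ n)| = δ * Dfun r n (q / 2 ^ n)
        ∧ |Dfun r n (q / 2 ^ n)| + r n * δ' = |Dfun r n (q / 2 ^ n) + r n * δ| := by
      obtain ⟨d, hd, -⟩ := exists_intCast_eq_Dfun hr n (q / 2 ^ n)
      rw [hd]
      have hrδ : -1 ≤ r n * δ ∧ r n * δ ≤ 1 ∧ |r n * δ| = 1 := by
        rcases hr n with h | h <;> rcases hδ with rfl | rfl <;> norm_num [h]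
      rcases lt_trichotomy d 0 with hd | rfl | hd
      · have hd' : (d : ℝ) ≤ -1 := by exact_mod_cast Int.le_sub_one_of_lt hd
        refine ⟨-δ, by rcases hδ with rfl | rfl <;> simp, ?_, ?_⟩
        · rw [abs_of_neg (by linarith)]
          ring
        · rw [abs_of_neg (by linarith), abs_of_nonpos (by linarith)]
          ring
      · refine ⟨r n, hr n, by simp, ?_⟩
        rw [Int.cast_zero, zero_add, hrδ.2.2]
        rcases hr n with h | h <;> simp [h]
      · have hd' : (1 : ℝ) ≤ d := by exact_mod_cast hd
        refine ⟨δ, hδ, ?_, ?_⟩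
        · rw [abs_of_pos (by linarith)]
        · rw [abs_of_pos (by linarith), abs_of_nonneg (by linarith)]
    obtain ⟨δ', hδ', hmul, habs⟩ := key
    obtain ⟨e', he', heδ'⟩ : ∃ e' : ℤ, (e' = 0 ∨ e' = 1) ∧ (e' = 0 ∧ δ' = 1 ∨ e' = 1 ∧ δ' = -1) := by
      rcases hδ' with rfl | rfl
      · exact ⟨0, by simp⟩
      · exact ⟨1, by simp⟩
    refine ⟨2 * q' + e', by omega, by rw [pow_succ]; omega, fun j hj => ?_, ?_⟩
    · rcases hj.lt_or_eq with hj | rfl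
      · rw [Dfun_dyadic_child_of_le r (by omega) q' he', Dfun_dyadic_child_of_le r (by omega) q he,
          hD j (by omega)]
      · rw [Dfun_dyadic_child r n q' heδ', Dfun_dyadic_child r n q heδ, hDn, habs]
    · rw [chord_midpoint_dyadic_child hr n q' heδ', chord_midpoint_dyadic_child hr n q heδ, hM, hDn,
        hmul]

theorem tendsto_floor_two_pow_div (x : ℝ) :
    Filter.Tendsto (fun n : ℕ => (⌊2 ^ n * x⌋ / 2 ^ n : ℝ)) Filter.atTop (nhds x) := by
  have h := tendsto_const_nhds (x := x).sub (tendsto_pow_atTop_nhds_zero_of_lt_one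
    (r := (1 / 2 : ℝ)) (by norm_num) (by norm_num))
  rw [sub_zero] at h
  refine tendsto_of_tendsto_of_tendsto_of_le_of_le h tendsto_const_nhds (fun n => ?_) fun n => ?_
  · have := Int.lt_floor_add_one (2 ^ n * x)
    simp only [one_div_pow]
    rw [le_div_iff₀ (by positivity), sub_mul, one_div_mul_cancel (by positivity)]
    linarith
  · have := Int.floor_le (2 ^ n * x)
    simp only
    rw [div_le_iff₀ (by positivity)]
    linarith

theorem takagi_floor_le {r : ℕ → ℝ} (hr : ∀ n, r n = 1 ∨ r n = -1) {N : ℕ} {x : ℝ}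
    (hx : ∀ j, N ≤ j → 1 ≤ Dfun r j x) {n : ℕ} (hn : N ≤ n) :
    takagi r (⌊2 ^ n * x⌋ / 2 ^ n) ≤ takagi r x := by
  have step (n : ℕ) (hn : N ≤ n) :
      takagi r (⌊2 ^ n * x⌋ / 2 ^ n) ≤ takagi r (⌊2 ^ (n + 1) * x⌋ / 2 ^ (n + 1)) := by
    have h := floor_two_pow_succ_div_two n x
    obtain h' | h' : ⌊2 ^ (n + 1) * x⌋ = 2 * ⌊2 ^ n * x⌋ ∨
      ⌊2 ^ (n + 1) * x⌋ = 2 * ⌊2 ^ n * x⌋ + 1 := by omega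
    · rw [h']
      refine (congrArg _ ?_).le
      push_cast
      rw [pow_succ]
      field_simp
    · rw [h']
      push_cast
      rw [takagi_dyadic_midpoint hr, Dfun_floor]
      have := hx n hn
      have : 0 ≤ (Dfun r n x + r n) / 2 ^ (n + 1) :=
        div_nonneg (by rcases hr n with h | h <;> linarith) (by positivity)
      linarith
  have lim := tendsto_floor_two_pow_div x
  refine ge_of_tendsto (((continuous_takagi hr).tendsto x).comp lim) ?_
  filter_upwards [Filter.eventually_ge_atTop n] with m hm
  induction m, hm using Nat.le_induction with
  | base => exact le_rfl
  | succ m hm ih => exact ih.trans (step m (hn.trans hm))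

theorem takagi_floor_add_one_antitone {r : ℕ → ℝ} (hr : ∀ n, r n = 1 ∨ r n = -1) {N : ℕ} {x : ℝ}
    (hx : ∀ j, N ≤ j → 1 ≤ Dfun r j x) {n m : ℕ} (hn : N ≤ n) (hm : n ≤ m) :
    takagi r ((⌊2 ^ m * x⌋ + 1) / 2 ^ m) ≤ takagi r ((⌊2 ^ n * x⌋ + 1) / 2 ^ n) := by
  induction m, hm using Nat.le_induction with
  | base => exact le_rfl
  | succ m hm ih =>
    refine le_trans ?_ ih
    have h := floor_two_pow_succ_div_two m x
    obtain h' | h' : ⌊2 ^ (m + 1) * x⌋ = 2 * ⌊2 ^ m * x⌋ ∨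
      ⌊2 ^ (m + 1) * x⌋ = 2 * ⌊2 ^ m * x⌋ + 1 := by omega
    · rw [h']
      push_cast
      rw [takagi_dyadic_midpoint hr, takagi_intCast_add_one_div hr, Dfun_floor]
      have := hx m (hn.trans hm)
      have : 0 ≤ (Dfun r m x - r m) / 2 ^ (m + 1) :=
        div_nonneg (by rcases hr m with h | h <;> linarith) (by positivity)
      have e : Dfun r m x / 2 ^ m =
          (Dfun r m x + r m) / 2 ^ (m + 1) + (Dfun r m x - r m) / 2 ^ (m + 1) := by
        rw [pow_succ]
        field_simp
        ring
      linarith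
    · rw [h']
      refine (congrArg _ ?_).le
      push_cast
      rw [pow_succ]
      field_simp
      ring

theorem takagi_le_takagi_floor_add_one {r : ℕ → ℝ} (hr : ∀ n, r n = 1 ∨ r n = -1) {N : ℕ} {x : ℝ}
    (hx : ∀ j, N ≤ j → 1 ≤ Dfun r j x) {n : ℕ} (hn : N ≤ n) :
    takagi r x ≤ takagi r ((⌊2 ^ n * x⌋ + 1) / 2 ^ n) := by
  have lim : Filter.Tendsto (fun n : ℕ => ((⌊2 ^ n * x⌋ + 1) / 2 ^ n : ℝ)) Filter.atTop
      (nhds x) := by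
    have h := (tendsto_floor_two_pow_div x).add (tendsto_pow_atTop_nhds_zero_of_lt_one
      (r := (1 / 2 : ℝ)) (by norm_num) (by norm_num))
    rw [add_zero] at h
    refine h.congr fun n => ?_
    rw [one_div_pow, add_div]
  refine le_of_tendsto (((continuous_takagi hr).tendsto x).comp lim) ?_
  filter_upwards [Filter.eventually_ge_atTop n] with m hm
  exact takagi_floor_add_one_antitone hr hx hn hm

theorem takagi_lt_takagi_floor_add_one {r : ℕ → ℝ} (hr : ∀ n, r n = 1 ∨ r n = -1) {N : ℕ} {p : ℕ}
    {k : ℤ} {x : ℝ} (hxk : x = k / 2 ^ p)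
    (hx : ∀ j, N ≤ j → 1 ≤ Dfun r j x) {n : ℕ} (hn : N ≤ n) :
    takagi r x < takagi r ((⌊2 ^ n * x⌋ + 1) / 2 ^ n) := by
  refine lt_of_lt_of_le ?_ (takagi_floor_add_one_antitone hr hx hn (Nat.le_add_right n p))
  have e : (2 : ℝ) ^ (n + p) * x = ((2 ^ n * k : ℤ) : ℝ) := by
    rw [hxk, pow_add]
    push_cast
    field_simp
  have e' : (⌊(2 : ℝ) ^ (n + p) * x⌋ : ℝ) / 2 ^ (n + p) = x := by
    rw [e, Int.floor_intCast, ← e]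
    field_simp
  rw [takagi_intCast_add_one_div hr, e']
  have := hx (n + p) (by omega)
  have : 0 < Dfun r (n + p) x / 2 ^ (n + p) := by positivity
  linarith

/-- Two points of a common dyadic interval of order `N` are separated by a dyadic point. -/
theorem exists_floor_two_pow_succ_eq {N : ℕ} {x x' : ℝ} (hN : ⌊2 ^ N * x⌋ = ⌊2 ^ N * x'⌋)
    (hlt : x < x') : ∃ n, N ≤ n ∧ ⌊2 ^ n * x'⌋ = ⌊2 ^ n * x⌋ + 1 := by
  have hex : ∃ n, ⌊2 ^ n * x⌋ ≠ ⌊2 ^ n * x'⌋ := by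
    by_contra! h
    exact hlt.ne (tendsto_nhds_unique (tendsto_floor_two_pow_div x)
      (by simpa only [h] using tendsto_floor_two_pow_div x'))
  classical
  have hspec := Nat.find_spec hex
  have hmin := fun m => Nat.find_min hex (m := m)
  generalize Nat.find hex = n at hspec hmin
  have hn : N < n := by
    by_contra! h
    exact hspec (floor_two_pow_congr hN h)
  refine ⟨n, hn.le, ?_⟩
  obtain ⟨m, rfl⟩ : ∃ m, n = m + 1 := ⟨n - 1, by omega⟩
  have hm := not_not.1 (hmin m (by omega))
  rw [← floor_two_pow_succ_div_two m x, ← floor_two_pow_succ_div_two m x'] at hm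
  have : ⌊2 ^ (m + 1) * x⌋ ≤ ⌊2 ^ (m + 1) * x'⌋ := Int.floor_mono (by gcongr)
  omega

theorem one_le_Dfun_of_ne_zero {r : ℕ → ℝ} (hr : ∀ n, r n = 1 ∨ r n = -1) {N : ℕ} {x : ℝ}
    (hpos : 0 < Dfun r N x) (hne : ∀ j, N ≤ j → Dfun r j x ≠ 0) {j : ℕ} (hj : N ≤ j) :
    1 ≤ Dfun r j x := by
  have int {j : ℕ} (h : 0 < Dfun r j x) : 1 ≤ Dfun r j x := by
    obtain ⟨d, hd, -⟩ := exists_intCast_eq_Dfun hr j x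
    rw [hd] at h ⊢
    exact_mod_cast h
  induction j, hj using Nat.le_induction with
  | base => exact int hpos
  | succ j hj ih =>
    refine int (lt_of_le_of_ne ?_ (hne (j + 1) (by omega)).symm)
    rw [Dfun_succ]
    rcases hr j with h | h <;>
      rcases neg_one_pow_eq_or ℝ (⌊2 ^ (j + 1) * x⌋ % 2).toNat with h' | h' <;> rw [h, h'] <;>
      linarith

theorem finite_level_set_of_Dfun_pos {r : ℕ → ℝ} (hr : ∀ n, r n = 1 ∨ r n = -1) {y : ℝ} {N : ℕ}
    {K : ℤ} (hpos : 0 < Dfun r N (K / 2 ^ N))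
    (hne : ∀ x, ⌊2 ^ N * x⌋ = K → takagi r x = y → ∀ j, N ≤ j → Dfun r j x ≠ 0) :
    {x : ℝ | ⌊2 ^ N * x⌋ = K ∧ takagi r x = y}.Finite := by
  have one_le {x : ℝ} (hx : ⌊2 ^ N * x⌋ = K) (hxy : takagi r x = y) (j : ℕ) (hj : N ≤ j) :
      1 ≤ Dfun r j x := by
    refine one_le_Dfun_of_ne_zero hr ?_ (hne x hx hxy) hj
    rwa [← Dfun_floor, hx]
  refine Set.finite_of_forall_not_lt_lt ?_
  rintro u ⟨hu, huy⟩ v ⟨hv, hvy⟩ w ⟨hw, hwy⟩ huv hvw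
  obtain ⟨n, hn, hn'⟩ := exists_floor_two_pow_succ_eq (hu.trans hv.symm) huv
  set c : ℝ := ⌊2 ^ n * v⌋ / 2 ^ n with hc
  have hcK : ⌊2 ^ N * c⌋ = K := by
    rw [← hv]
    exact floor_two_pow_congr (floor_two_pow_mul_intCast_div n _) hn
  have hcy : takagi r c = y := by
    refine le_antisymm ?_ ?_
    · rw [← hvy]
      exact takagi_floor_le hr (one_le hv hvy) hn
    · rw [← huy, hc, hn']
      push_cast
      exact takagi_le_takagi_floor_add_one hr (one_le hu huy) hn
  have hcv : c ≤ v := by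
    rw [hc, div_le_iff₀ (by positivity), mul_comm]
    exact Int.floor_le _
  obtain ⟨m, hm, hm'⟩ := exists_floor_two_pow_succ_eq (hcK.trans hw.symm) (hcv.trans_lt hvw)
  have h1 := takagi_lt_takagi_floor_add_one hr hc (one_le hcK hcy) hm
  have h2 := takagi_floor_le hr (one_le hw hwy) hm
  rw [hm'] at h2
  push_cast at h2
  rw [hwy] at h2
  rw [hcy] at h1
  exact h1.not_ge h2

theorem finite_level_set_of_Dfun_ne_zero {r : ℕ → ℝ} (hr : ∀ n, r n = 1 ∨ r n = -1) {y : ℝ} {N : ℕ}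
    {K : ℤ} (hne : ∀ x, ⌊2 ^ N * x⌋ = K → takagi r x = y → ∀ j, N ≤ j → Dfun r j x ≠ 0) :
    {x : ℝ | ⌊2 ^ N * x⌋ = K ∧ takagi r x = y}.Finite := by
  rcases lt_trichotomy (Dfun r N (K / 2 ^ N)) 0 with h | h | h
  · have := finite_level_set_of_Dfun_pos (r := fun n => -r n) (y := -y) (N := N) (K := K)
      (fun n => by rcases hr n with h | h <;> simp [h]) (by rw [Dfun_neg]; linarith)
      (by simpa only [takagi_neg, Dfun_neg, neg_inj, neg_ne_zero] using hne)
    simpa only [takagi_neg, neg_inj] using this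
  · refine Set.Finite.subset Set.finite_empty ?_
    rintro x ⟨hx, hxy⟩
    refine hne x hx hxy N le_rfl ?_
    rwa [← Dfun_floor, hx]
  · exact finite_level_set_of_Dfun_pos hr h hne

/-- A zero of the walk `Dfun` at a point of the level set produces a principal balanced pair of the
same order whose hump meets the level. -/
theorem exists_principal_of_Dfun_eq_zero {r : ℕ → ℝ} (hr : ∀ n, r n = 1 ∨ r n = -1) {x : ℝ}
    (h0 : 0 ≤ x) (h1 : x < 1) {j : ℕ} (hj : Dfun r j x = 0) :
    ∃ k m : ℕ, j = 2 * m ∧ BalancedPair r k m ∧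
      (∀ j, 1 ≤ j → j ≤ 2 * m → 0 ≤ Dfun r j ((k : ℝ) / 2 ^ (2 * m))) ∧
      takagi r x ∈ takagi r '' Set.Icc ((k : ℝ) / 2 ^ (2 * m)) (((k : ℝ) + 1) / 2 ^ (2 * m)) := by
  obtain ⟨d, hd, hpar⟩ := exists_intCast_eq_Dfun hr j x
  obtain rfl : d = 0 := by
    rw [hj] at hd
    exact_mod_cast hd.symm
  obtain ⟨m, rfl⟩ : ∃ m, j = 2 * m := ⟨j / 2, by omega⟩
  have hpow : (0 : ℝ) < 2 ^ (2 * m) := by positivity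
  have hK0 : 0 ≤ ⌊2 ^ (2 * m) * x⌋ := Int.floor_nonneg.2 (by positivity)
  have hK1 : ⌊2 ^ (2 * m) * x⌋ < 2 ^ (2 * m) := by
    rw [Int.floor_lt]
    push_cast
    exact mul_lt_of_lt_one_right hpow h1
  obtain ⟨k, hk0, hk1, hD, hM⟩ := exists_dyadic_Dfun_eq_abs hr (2 * m) _ hK0 hK1
  have hz := hD _ le_rfl
  rw [Dfun_floor, hj, abs_zero] at hz
  rw [hz, Dfun_floor, hj, zero_div, add_zero, add_zero] at hM
  lift k to ℕ using hk0
  rw [Int.cast_natCast] at hz hM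
  refine ⟨k, m, rfl, ⟨by exact_mod_cast hk1, hz⟩, fun i _ hi => ?_, ?_⟩
  · have := hD i hi
    rw [Int.cast_natCast] at this
    rw [this]
    exact abs_nonneg _
  · have ht0 := Int.fract_nonneg (2 ^ (2 * m) * x)
    have ht1 := (Int.fract_lt_one (2 ^ (2 * m) * x)).le
    have hx : x = (⌊2 ^ (2 * m) * x⌋ + Int.fract (2 ^ (2 * m) * x)) / 2 ^ (2 * m) := by
      rw [Int.floor_add_fract]
      field_simp
    refine ⟨(k + Int.fract (2 ^ (2 * m) * x)) / 2 ^ (2 * m), ⟨?_, ?_⟩, ?_⟩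
    · gcongr
      linarith
    · gcongr
    · have e1 := takagi_intCast_add_div hr (2 * m) k ht0 ht1
      have e2 := takagi_intCast_add_div hr (2 * m) ⌊2 ^ (2 * m) * x⌋ ht0 ht1
      rw [← hx, Dfun_floor, hj] at e2
      rw [Int.cast_natCast, hz, hM] at e1
      rw [e1, e2]

/-- If `y` is not the value of `f` at the left endpoint of any balanced pair,
and only finitely many principal balanced pairs `(k, m)` satisfy
`y ∈ f(I(k, m))`, then the level set `L_f(y)` is finite. -/
theorem level_set_finite_of_finitely_many_principal_humps
    (r : ℕ → ℝ) (hr : ∀ n, r n = 1 ∨ r n = -1) (y : ℝ)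
    (hy : ∀ k m : ℕ, BalancedPair r k m → takagi r ((k : ℝ) / 2 ^ (2 * m)) ≠ y)
    (hfin : {p : ℕ × ℕ | BalancedPair r p.1 p.2 ∧
        (∀ j, 1 ≤ j → j ≤ 2 * p.2 → 0 ≤ Dfun r j ((p.1 : ℝ) / 2 ^ (2 * p.2))) ∧
        y ∈ takagi r ''
          Set.Icc ((p.1 : ℝ) / 2 ^ (2 * p.2)) (((p.1 : ℝ) + 1) / 2 ^ (2 * p.2))}.Finite) :
    {x : ℝ | x ∈ Set.Icc (0 : ℝ) 1 ∧ takagi r x = y}.Finite := by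
  obtain ⟨M, hM⟩ := (hfin.image Prod.snd).bddAbove
  have hne (x : ℝ) (h0 : 0 ≤ x) (h1 : x < 1) (hxy : takagi r x = y) (j : ℕ)
      (hj : 2 * (M + 1) ≤ j) : Dfun r j x ≠ 0 := by
    intro hz
    obtain ⟨k, m, rfl, hbal, hprin, himg⟩ := exists_principal_of_Dfun_eq_zero hr h0 h1 hz
    rw [hxy] at himg
    have : m ≤ M := hM ⟨(k, m), ⟨hbal, hprin, himg⟩, rfl⟩
    omega
  have hpow : (0 : ℝ) < 2 ^ (2 * (M + 1)) := by positivity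
  refine (((Set.finite_Ico (0 : ℤ) (2 ^ (2 * (M + 1)))).biUnion fun K hK =>
    finite_level_set_of_Dfun_ne_zero (r := r) (y := y) (N := 2 * (M + 1)) (K := K) hr
      ?_).union (Set.finite_singleton 1)).subset ?_
  · rintro x hx hxy j hj
    have hKx := Int.floor_le (2 ^ (2 * (M + 1)) * x)
    rw [hx] at hKx
    refine hne x ?_ ?_ hxy j hj
    · have : (0 : ℝ) ≤ K := by exact_mod_cast hK.1
      exact nonneg_of_mul_nonneg_right (this.trans hKx) hpow
    · have h := hx ▸ hK.2
      rw [Int.floor_lt] at h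
      push_cast at h
      exact (mul_lt_iff_lt_one_right hpow).1 h
  · rintro x ⟨⟨h0, h1⟩, hxy⟩
    rcases h1.lt_or_eq with h1 | rfl
    · refine Or.inl (Set.mem_biUnion (x := ⌊2 ^ (2 * (M + 1)) * x⌋) ⟨?_, ?_⟩ ⟨rfl, hxy⟩)
      · exact Int.floor_nonneg.2 (by positivity)
      · rw [Int.floor_lt]
        push_cast
        exact mul_lt_of_lt_one_right hpow h1
    · exact Or.inr rfl
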